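/- Let n be a nonnegative integer and a, b, c, q, w ∈ ℂ. Assume a − q ≠ 0 and 1+2q−w+n ≠ 0, and set α = q(1+a−w)/(a−q) and β = (q(1+a−w)+n(a−q))/(1+2q−w+n). Assume the parameters are nondegenerate for the identity below. Then ₅F₄(a, b, c, q+1, −n; 1+a−b, 1+a−c, q, w; 1) = ((w−a−1)_n (α+1)_n / ((w)_n (α)_n)) · ₆F₅(1+a−w, a/2, (a+1)/2, 1+a−b−c, β+1, −n; 1+a−b, 1+a−c, (2+a−w−n)/2, (3+a−w−n)/2, β; 1). -/

import Mathlib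

/-- Rising factorial (Pochhammer symbol) `(a)ₖ = a(a+1)⋯(a+k−1)`. -/
noncomputable def poch (a : ℂ) (k : ℕ) : ℂ := (ascPochhammer ℂ k).eval a

/-- Terminating hypergeometric sum with numerator parameters `A` together with
the extra top parameter `-n`, denominator parameters `B`, and argument `x`. -/
noncomputable def hypTerm (A B : List ℂ) (n : ℕ) (x : ℂ) : ℂ :=
  ∑ k ∈ Finset.range (n + 1),
    ((A.map fun a => poch a k).prod * poch (-(n : ℂ)) k) /
      ((k.factorial : ℂ) * (B.map fun b => poch b k).prod) * x ^ k

open Finset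

lemma poch_zero (a : ℂ) : poch a 0 = 1 := by simp [poch]

lemma poch_succ (a : ℂ) (k : ℕ) : poch a (k + 1) = poch a k * (a + k) := by
  simp [poch, ascPochhammer_succ_eval]

lemma poch_add (a : ℂ) (m k : ℕ) : poch a (m + k) = poch a m * poch (a + m) k := by
  induction k with
  | zero => simp [poch_zero]
  | succ k ih => rw [← add_assoc, poch_succ, poch_succ, ih]; push_cast; ring

lemma poch_succ_left (a : ℂ) (k : ℕ) : poch a (k + 1) = a * poch (a + 1) k := by
  rw [add_comm, poch_add, poch_succ, poch_zero]; simp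

lemma mul_poch_add_one (a : ℂ) (k : ℕ) : a * poch (a + 1) k = poch a k * (a + k) := by
  rw [← poch_succ_left, poch_succ]

lemma poch_reflect (a : ℂ) (k : ℕ) : poch (1 - a - k) k = (-1) ^ k * poch a k := by
  induction k with
  | zero => simp [poch_zero]
  | succ k ih =>
    rw [poch_succ_left, poch_succ, pow_succ,
      show 1 - a - ((k + 1 : ℕ) : ℂ) + 1 = 1 - a - k by push_cast; ring, ih]
    push_cast; ring

lemma poch_two_mul (a : ℂ) (k : ℕ) :
    poch a (2 * k) = 4 ^ k * (poch (a / 2) k * poch ((a + 1) / 2) k) := by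
  induction k with
  | zero => simp [poch_zero]
  | succ k ih =>
    rw [show 2 * (k + 1) = 2 * k + 1 + 1 by ring, poch_succ, poch_succ, ih, poch_succ, poch_succ]
    push_cast; ring

lemma poch_ne_zero_of_le {a : ℂ} {j k : ℕ} (h : poch a k ≠ 0) (hjk : j ≤ k) : poch a j ≠ 0 := by
  obtain ⟨m, rfl⟩ := Nat.exists_eq_add_of_le hjk
  rw [poch_add] at h
  exact left_ne_zero_of_mul h

lemma poch_neg_add_mul_factorial (i j : ℕ) :
    poch (-((j + i : ℕ) : ℂ)) j * i.factorial = (-1) ^ j * (j + i).factorial := by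
  induction j generalizing i with
  | zero => simp [poch_zero]
  | succ j ih =>
    have h := ih (i + 1)
    rw [show j + (i + 1) = j + 1 + i by ring, Nat.factorial_succ i] at h
    rw [poch_succ, pow_succ]
    push_cast at h ⊢
    linear_combination (-1 : ℂ) * h

lemma poch_neg_eq_zero {j k : ℕ} (h : k < j) : poch (-(k : ℂ)) j = 0 := by
  obtain ⟨m, rfl⟩ := Nat.exists_eq_add_of_le (Nat.succ_le_of_lt h)
  rw [poch_add, Nat.succ_eq_add_one, poch_succ]
  simp

/-- Coefficientwise form of Euler's transformation of `₂F₁`, that is, the Pfaff–Saalschütz sum. -/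
lemma sum_antidiagonal_euler (A B C E : ℂ) (hC : C = A + B + E) (k : ℕ) (hk : poch C k ≠ 0) :
    ∑ p ∈ antidiagonal k, poch A p.1 * poch B p.1 / (p.1.factorial * poch C p.1) *
        (poch E p.2 / p.2.factorial) =
      poch (A + E) k * poch (B + E) k / (k.factorial * poch C k) := by
  induction k with
  | zero => simp [poch_zero]
  | succ k ih =>
    have hk' := poch_ne_zero_of_le hk (Nat.le_succ k)
    have ih := ih hk'
    have hCk : C + k ≠ 0 := by rw [poch_succ] at hk; exact right_ne_zero_of_mul hk
    have hk1 : (k + 1 : ℂ) ≠ 0 := by exact_mod_cast Nat.succ_ne_zero k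
    set u : ℕ → ℂ := fun j => poch A j * poch B j / (j.factorial * poch C j) with hu
    set v : ℕ → ℂ := fun j => poch E j / j.factorial with hv
    have hus : ∀ j ≤ k, (j + 1) * (C + j) * u (j + 1) = (A + j) * (B + j) * u j := by
      intro j hj
      have h1 := poch_ne_zero_of_le hk (Nat.succ_le_succ hj)
      rw [Nat.succ_eq_add_one, poch_succ] at h1
      have h2 := left_ne_zero_of_mul h1
      have h3 := right_ne_zero_of_mul h1
      have h4 : (j + 1 : ℂ) ≠ 0 := by exact_mod_cast Nat.succ_ne_zero j
      have h5 : (j.factorial : ℂ) ≠ 0 := by exact_mod_cast j.factorial_ne_zero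
      simp only [hu, poch_succ, Nat.factorial_succ]
      push_cast
      field_simp
    have hvs : ∀ i : ℕ, (i + 1) * v (i + 1) = (E + i) * v i := by
      intro i
      have h4 : (i + 1 : ℂ) ≠ 0 := by exact_mod_cast Nat.succ_ne_zero i
      have h5 : (i.factorial : ℂ) ≠ 0 := by exact_mod_cast i.factorial_ne_zero
      simp only [hv, poch_succ, Nat.factorial_succ]
      push_cast
      field_simp
    have hrec : (k + 1) * (C + k) * ∑ p ∈ antidiagonal (k + 1), u p.1 * v p.2 =
        (A + E + k) * (B + E + k) * ∑ p ∈ antidiagonal k, u p.1 * v p.2 := by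
      calc _ = ∑ p ∈ antidiagonal (k + 1), (C + k + p.1) * u p.1 * (p.2 * v p.2) +
            ∑ p ∈ antidiagonal (k + 1), p.1 * (C + p.1 - 1) * u p.1 * v p.2 := by
            rw [mul_sum, ← sum_add_distrib]
            refine sum_congr rfl fun p hp => ?_
            have : (p.1 + p.2 : ℂ) = k + 1 := by exact_mod_cast mem_antidiagonal.1 hp
            have h2 : (k : ℂ) = p.1 + p.2 - 1 := by linear_combination -this
            rw [h2]; ring
        _ = ∑ p ∈ antidiagonal k, (C + k + p.1) * u p.1 * ((E + p.2) * v p.2) +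
            ∑ p ∈ antidiagonal k, (A + p.1) * (B + p.1) * u p.1 * v p.2 := by
            rw [Nat.sum_antidiagonal_succ', Nat.sum_antidiagonal_succ]
            simp only [Nat.cast_zero, zero_mul, mul_zero, zero_add, add_zero]
            congr 1
            · refine sum_congr rfl fun p _ => ?_
              rw [← hvs]; push_cast; ring
            · refine sum_congr rfl fun p hp => ?_
              rw [← hus _ (by have := mem_antidiagonal.1 hp; omega)]; push_cast; ring
        _ = _ := by
            rw [mul_sum, ← sum_add_distrib]
            refine sum_congr rfl fun p hp => ?_
            have : (p.1 + p.2 : ℂ) = k := by exact_mod_cast mem_antidiagonal.1 hp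
            rw [hC, ← this]; ring
    rw [ih] at hrec
    have h5 : (k.factorial : ℂ) ≠ 0 := by exact_mod_cast k.factorial_ne_zero
    apply mul_left_cancel₀ (mul_ne_zero hk1 hCk)
    rw [hrec]
    simp only [poch_succ, Nat.factorial_succ]
    push_cast
    field_simp

lemma sum_saalschutz (a b c : ℂ) (k : ℕ) (hb : poch (1 + a - b) k ≠ 0)
    (hc : poch (1 + a - c) k ≠ 0) :
    ∑ j ∈ range (k + 1), poch (-(k : ℂ)) j * poch (a + k) j *
        (poch (1 + a - b - c) j / (j.factorial * poch (1 + a - b) j * poch (1 + a - c) j)) =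
      poch b k * poch c k / (poch (1 + a - b) k * poch (1 + a - c) k) := by
  have h := sum_antidiagonal_euler (a + k) (1 + a - b - c) (1 + a - b) (c - a - k) (by ring) k hb
  have hk : (k.factorial : ℂ) ≠ 0 := by exact_mod_cast k.factorial_ne_zero
  have hsq : ((-1 : ℂ) ^ k) * (-1) ^ k = 1 := by rw [← mul_pow]; simp
  rw [show a + k + (c - a - k) = c by ring,
    show 1 + a - b - c + (c - a - k) = 1 - b - k by ring, poch_reflect] at h
  have key : poch b k * poch c k / (poch (1 + a - b) k * poch (1 + a - c) k) =
      (-1) ^ k * k.factorial / poch (1 + a - c) k *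
        (poch c k * ((-1) ^ k * poch b k) / (k.factorial * poch (1 + a - b) k)) := by
    field_simp
    linear_combination (-(poch b k * poch c k)) * hsq
  rw [key, ← h, mul_sum, Nat.sum_antidiagonal_eq_sum_range_succ_mk]
  refine sum_congr rfl fun j hj => ?_
  have hjk : j ≤ k := Nat.lt_succ_iff.1 (mem_range.1 hj)
  obtain ⟨i, rfl⟩ := Nat.exists_eq_add_of_le hjk
  have h1 := poch_ne_zero_of_le hb hjk
  have h3 := hc
  rw [poch_add] at h3
  have h4 := left_ne_zero_of_mul h3
  have h5 := right_ne_zero_of_mul h3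
  have hi : (i.factorial : ℂ) ≠ 0 := by exact_mod_cast i.factorial_ne_zero
  have hj' : (j.factorial : ℂ) ≠ 0 := by exact_mod_cast j.factorial_ne_zero
  have h6 : poch (c - a - ((j + i : ℕ) : ℂ)) i = (-1) ^ i * poch (1 + a - c + j) i := by
    rw [← poch_reflect]; congr 1; push_cast; ring
  have h7 : poch (-((j + i : ℕ) : ℂ)) j = (-1) ^ j * (j + i).factorial / i.factorial := by
    rw [eq_div_iff hi, poch_neg_add_mul_factorial]
  have hsqi : ((-1 : ℂ) ^ i) * (-1) ^ i = 1 := by rw [← mul_pow]; simp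
  simp only [Nat.add_sub_cancel_left]
  rw [h6, h7, poch_add (1 + a - c), pow_add]
  field_simp
  rw [pow_two, hsqi, mul_one]

/-- The Chu–Vandermonde sum. -/
lemma sum_chu_vandermonde (A W : ℂ) (N : ℕ) (hW : poch W N ≠ 0) :
    ∑ m ∈ range (N + 1), (-1) ^ m * (N.choose m : ℂ) * (poch A m / poch W m) =
      poch (W - A) N / poch W N := by
  induction N generalizing W with
  | zero => simp [poch_zero]
  | succ N ih =>
    have hW' := hW
    rw [poch_succ_left] at hW'
    have h0 := left_ne_zero_of_mul hW'
    have h1 := right_ne_zero_of_mul hW'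
    have hrec : ∑ m ∈ range (N + 1 + 1), (-1) ^ m * ((N + 1).choose m : ℂ) *
          (poch A m / poch W m) =
        ∑ m ∈ range (N + 1), (-1) ^ m * (N.choose m : ℂ) *
          (poch A m / poch W m - poch A (m + 1) / poch W (m + 1)) := by
      have hsplit : ∑ m ∈ range (N + 1), (-1) ^ m * (N.choose m : ℂ) * (poch A m / poch W m) =
          ∑ m ∈ range (N + 1), (-1) ^ (m + 1) * (N.choose (m + 1) : ℂ) *
            (poch A (m + 1) / poch W (m + 1)) + 1 := by
        rw [sum_range_succ' _ N, sum_range_succ _ N]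
        simp [poch_zero]
      simp only [mul_sub, sum_sub_distrib]
      rw [hsplit, sum_range_succ']
      simp only [Nat.choose_succ_succ, Nat.succ_eq_add_one]
      rw [add_sub_right_comm, ← sum_sub_distrib]
      congr 1
      · refine sum_congr rfl fun m _ => ?_
        push_cast; ring
      · simp [poch_zero]
    rw [hrec]
    calc _ = (W - A) / W * ∑ m ∈ range (N + 1), (-1) ^ m * (N.choose m : ℂ) *
            (poch A m / poch (W + 1) m) := by
          rw [mul_sum]
          refine sum_congr rfl fun m hm => ?_
          have hm' : m + 1 ≤ N + 1 := Nat.succ_le_of_lt (mem_range.1 hm)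
          have h2 := poch_ne_zero_of_le hW hm'
          have h3 := mul_poch_add_one W m
          rw [poch_succ] at h2
          have h4 := left_ne_zero_of_mul h2
          have h5 := right_ne_zero_of_mul h2
          have h6 : poch (W + 1) m = poch W m * (W + m) / W := by
            rw [eq_div_iff h0, ← h3]; ring
          rw [h6, poch_succ, poch_succ]
          field_simp
          ring
      _ = _ := by
          rw [ih (W + 1) h1, poch_succ_left W, poch_succ, show W + 1 - A = W - A + 1 by ring]
          have h3 := mul_poch_add_one (W - A) N
          rw [← h3]
          field_simp

lemma poch_neg_div_factorial (N m : ℕ) :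
    poch (-(N : ℂ)) m / m.factorial = (-1) ^ m * (N.choose m : ℂ) := by
  have hm : (m.factorial : ℂ) ≠ 0 := by exact_mod_cast m.factorial_ne_zero
  rcases lt_or_ge N m with h | h
  · rw [poch_neg_eq_zero h, Nat.choose_eq_zero_of_lt h]; simp
  · obtain ⟨i, rfl⟩ := Nat.exists_eq_add_of_le h
    have hi : (i.factorial : ℂ) ≠ 0 := by exact_mod_cast i.factorial_ne_zero
    have h1 := poch_neg_add_mul_factorial i m
    have h2 : (((m + i).choose m : ℕ) : ℂ) * m.factorial * i.factorial = (m + i).factorial := by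
      have := Nat.choose_mul_factorial_mul_factorial h
      rw [Nat.add_sub_cancel_left] at this
      exact_mod_cast this
    rw [div_eq_iff hm]
    apply mul_right_cancel₀ hi
    rw [h1, ← h2]; ring

lemma sum_linear_mul_chu_vandermonde (A W p : ℂ) (N : ℕ) (hW : poch W N ≠ 0) :
    (W - A - 1) * ∑ m ∈ range (N + 1), poch (-(N : ℂ)) m / m.factorial *
        (poch A m * (p + m) / poch W m) =
      poch (W - A - 1) N / poch W N * (p * (W - A - 1 + N) - A * N) := by
  have hsum : ∑ m ∈ range (N + 1), poch (-(N : ℂ)) m / m.factorial *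
        (poch A m * (p + m) / poch W m) =
      (p - A) * ∑ m ∈ range (N + 1), (-1) ^ m * (N.choose m : ℂ) * (poch A m / poch W m) +
      A * ∑ m ∈ range (N + 1), (-1) ^ m * (N.choose m : ℂ) * (poch (A + 1) m / poch W m) := by
    rw [mul_sum, mul_sum, ← sum_add_distrib]
    refine sum_congr rfl fun m _ => ?_
    rw [poch_neg_div_factorial]
    linear_combination (-(-1) ^ m * (N.choose m : ℂ) / poch W m) * mul_poch_add_one A m
  rw [hsum, sum_chu_vandermonde A W N hW, sum_chu_vandermonde (A + 1) W N hW]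
  have h := mul_poch_add_one (W - A - 1) N
  rw [show W - A - 1 + 1 = W - A by ring] at h
  rw [show W - (A + 1) = W - A - 1 by ring]
  linear_combination (p - A) / poch W N * h

lemma poch_mul_poch_neg (v : ℂ) (j N : ℕ) :
    poch v (j + N) * poch (-v) j * (v - j) =
      v * (-1) ^ j * poch (v - j) N * poch (1 - v - ((j + N : ℕ) : ℂ)) (2 * j) := by
  have h1 : poch (1 - v - ((j + N : ℕ) : ℂ)) (2 * j) = poch (v - j + N) (2 * j) := by
    have := poch_reflect (v - j + N) (2 * j)
    rw [pow_mul] at this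
    simp only [even_two, Even.neg_pow, one_pow, one_mul] at this
    rw [← this]; congr 1; push_cast; ring
  have h2 : poch (v - j) N * poch (v - j + N) (2 * j) = poch (v - j) j * poch v (j + N) := by
    rw [← poch_add, show N + 2 * j = j + (j + N) by ring, poch_add (v - j) j]
    simp
  have h3 : poch (v - j) j = (-1) ^ j * poch (1 - v) j := by
    rw [← poch_reflect]; congr 1; ring
  have h4 := mul_poch_add_one (-v) j
  rw [show -v + 1 = 1 - v by ring] at h4
  have hsq : ((-1 : ℂ) ^ j) * (-1) ^ j = 1 := by rw [← mul_pow]; simp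
  rw [h1, mul_assoc (v * (-1) ^ j), h2, h3]
  linear_combination poch v (j + N) * h4 - v * poch (1 - v) j * poch v (j + N) * hsq

lemma sum_range_inner (a q w : ℂ) (j N : ℕ) (hq : poch q (j + N) ≠ 0) (hq0 : q ≠ 0)
    (hw : poch w (j + N) ≠ 0) :
    (w - a - 1 - j) * ∑ k ∈ range (j + N + 1),
        poch a k * poch (q + 1) k * poch (-((j + N : ℕ) : ℂ)) k /
          (k.factorial * (poch q k * poch w k)) * (poch (-(k : ℂ)) j * poch (a + k) j) =
      (-1) ^ j * poch a (2 * j) * poch (-((j + N : ℕ) : ℂ)) j * poch (w - a - 1 - j) N /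
        (q * poch w (j + N)) *
        ((q + j) * (w - a - 1 - j + N) - (a + 2 * j) * N) := by
  have hw' := hw
  rw [poch_add] at hw'
  have hwj := left_ne_zero_of_mul hw'
  have hwN := right_ne_zero_of_mul hw'
  have h := sum_linear_mul_chu_vandermonde (a + 2 * j) (w + j) (q + j) N hwN
  have hv : w + j - (a + 2 * j) - 1 = w - a - 1 - j := by ring
  rw [hv] at h
  have hsum : ∑ k ∈ range (j + N + 1),
        poch a k * poch (q + 1) k * poch (-((j + N : ℕ) : ℂ)) k /
          (k.factorial * (poch q k * poch w k)) * (poch (-(k : ℂ)) j * poch (a + k) j) =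
      (-1) ^ j * poch a (2 * j) * poch (-((j + N : ℕ) : ℂ)) j / (q * poch w j) *
      ∑ m ∈ range (N + 1), poch (-(N : ℂ)) m / m.factorial *
        (poch (a + 2 * j) m * (q + j + m) / poch (w + j) m) := by
    rw [add_assoc, sum_range_add, sum_eq_zero, zero_add, mul_sum]
    · refine sum_congr rfl fun m hm => ?_
      have hmN : m ≤ N := Nat.lt_succ_iff.1 (mem_range.1 hm)
      have hqm := poch_ne_zero_of_le hq (Nat.add_le_add_left hmN j)
      have hwm := poch_ne_zero_of_le hwN hmN
      have hm0 : (m.factorial : ℂ) ≠ 0 := by exact_mod_cast m.factorial_ne_zero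
      have hjm0 : ((j + m).factorial : ℂ) ≠ 0 := by exact_mod_cast (j + m).factorial_ne_zero
      have h7 : poch (-((j + m : ℕ) : ℂ)) j = (-1) ^ j * (j + m).factorial / m.factorial := by
        rw [eq_div_iff hm0, poch_neg_add_mul_factorial]
      have h8 : poch (q + 1) (j + m) = poch q (j + m) * (q + j + m) / q := by
        rw [eq_div_iff hq0, mul_comm, mul_poch_add_one]; push_cast; ring
      have h9 : poch (-((j + N : ℕ) : ℂ)) (j + m) =
          poch (-((j + N : ℕ) : ℂ)) j * poch (-(N : ℂ)) m := by
        rw [poch_add]; congr 2; push_cast; ring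
      have h10 : poch a (j + m) * poch (a + ((j + m : ℕ) : ℂ)) j =
          poch a (2 * j) * poch (a + 2 * j) m := by
        rw [← poch_add, show j + m + j = 2 * j + m by ring, poch_add]; push_cast; rfl
      rw [h7, h8, h9, poch_add w]
      generalize poch (a + 2 * j) m = Z at h10 ⊢
      field_simp
      linear_combination
        ((q + j + m) * poch (-((j + N : ℕ) : ℂ)) j * poch (-(N : ℂ)) m) * h10
    · intro k hk
      rw [poch_neg_eq_zero (mem_range.1 hk)]; simp
  rw [hsum, mul_left_comm, h, poch_add w]
  field_simp

theorem corollary_2C3P16 (n : ℕ) (a b c q w : ℂ)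
    (haq : a - q ≠ 0) (hqw : 1 + 2 * q - w + (n : ℂ) ≠ 0)
    (α β : ℂ)
    (hα : α = q * (1 + a - w) / (a - q))
    (hβ : β = (q * (1 + a - w) + (n : ℂ) * (a - q)) / (1 + 2 * q - w + (n : ℂ)))
    (hnd : ∀ z ∈ [1 + a - b, 1 + a - c, q, w,
        (2 + a - w - (n : ℂ)) / 2, (3 + a - w - (n : ℂ)) / 2, β, α],
      ∀ k ≤ n, poch z k ≠ 0) :
    hypTerm [a, b, c, q + 1] [1 + a - b, 1 + a - c, q, w] n 1
      = poch (w - a - 1) n * poch (α + 1) n / (poch w n * poch α n) *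
        hypTerm [1 + a - w, a / 2, (a + 1) / 2, 1 + a - b - c, β + 1]
          [1 + a - b, 1 + a - c, (2 + a - w - (n : ℂ)) / 2, (3 + a - w - (n : ℂ)) / 2, β]
          n 1 := by
  rcases Nat.eq_zero_or_pos n with rfl | hn
  · simp [hypTerm, poch_zero]
  have hB : poch (1 + a - b) n ≠ 0 := hnd _ (by simp) n le_rfl
  have hC : poch (1 + a - c) n ≠ 0 := hnd _ (by simp) n le_rfl
  have hq : poch q n ≠ 0 := hnd _ (by simp) n le_rfl
  have hw : poch w n ≠ 0 := hnd _ (by simp) n le_rfl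
  have hh1 : poch ((2 + a - w - (n : ℂ)) / 2) n ≠ 0 := hnd _ (by simp) n le_rfl
  have hh2 : poch ((3 + a - w - (n : ℂ)) / 2) n ≠ 0 := hnd _ (by simp) n le_rfl
  have hβn : poch β n ≠ 0 := hnd _ (by simp) n le_rfl
  have hαn : poch α n ≠ 0 := hnd _ (by simp) n le_rfl
  have hne : ∀ z : ℂ, poch z n ≠ 0 → z ≠ 0 := fun z hz => by
    simpa [poch_succ, poch_zero] using poch_ne_zero_of_le hz (Nat.succ_le_of_lt hn)
  have hq0 := hne q hq
  have hβ0 := hne β hβn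
  have hα0 := hne α hαn
  have hv0 : 1 + a - w ≠ 0 := by
    rintro h; apply hα0; rw [hα, h]; simp
  have hP : q * (1 + a - w) + (n : ℂ) * (a - q) ≠ 0 := by
    intro h; apply hβ0; rw [hβ, h]; simp
  have hαr : poch (α + 1) n / poch α n =
      (q * (1 + a - w) + (n : ℂ) * (a - q)) / (q * (1 + a - w)) := by
    have := mul_poch_add_one α n
    rw [div_eq_div_iff hαn (mul_ne_zero hq0 hv0)]
    apply mul_left_cancel₀ hα0
    have h2 : α * (a - q) = q * (1 + a - w) := by rw [hα]; field_simp
    linear_combination (q * (1 + a - w)) * this - n * poch α n * h2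
  have h2v : poch (2 + a - w - n) (2 * n) ≠ 0 := by
    rw [poch_two_mul, show 2 + a - w - (n : ℂ) + 1 = 3 + a - w - n by ring]
    exact mul_ne_zero (pow_ne_zero _ (by norm_num)) (mul_ne_zero hh1 hh2)
  have hvj : ∀ j ≤ n, w - a - 1 - (j : ℂ) ≠ 0 := by
    intro j hj h
    rcases Nat.eq_zero_or_pos j with rfl | hj0
    · apply hv0; push_cast at h; linear_combination -h
    have := poch_ne_zero_of_le h2v (show n - 1 + j + 1 ≤ 2 * n by omega)
    rw [poch_succ] at this
    apply right_ne_zero_of_mul this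
    push_cast [Nat.cast_sub hn]
    linear_combination -h
  have hexp : hypTerm [a, b, c, q + 1] [1 + a - b, 1 + a - c, q, w] n 1 =
      ∑ j ∈ range (n + 1),
        (poch (1 + a - b - c) j / (j.factorial * poch (1 + a - b) j * poch (1 + a - c) j)) *
        ∑ k ∈ range (n + 1), poch a k * poch (q + 1) k * poch (-(n : ℂ)) k /
          (k.factorial * (poch q k * poch w k)) * (poch (-(k : ℂ)) j * poch (a + k) j) := by
    simp only [mul_sum]
    rw [sum_comm, hypTerm]
    refine sum_congr rfl fun k hk => ?_
    have hkn : k ≤ n := Nat.lt_succ_iff.1 (mem_range.1 hk)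
    have hs := sum_saalschutz a b c k (poch_ne_zero_of_le hB hkn) (poch_ne_zero_of_le hC hkn)
    have hext : ∑ j ∈ range (n + 1), poch (-(k : ℂ)) j * poch (a + k) j *
        (poch (1 + a - b - c) j / (j.factorial * poch (1 + a - b) j * poch (1 + a - c) j)) =
        poch b k * poch c k / (poch (1 + a - b) k * poch (1 + a - c) k) := by
      rw [← hs]
      symm
      apply sum_subset (range_mono (Nat.succ_le_succ hkn))
      intro j _ hj
      rw [poch_neg_eq_zero (by simpa using hj)]; simp
    calc _ = poch a k * poch (q + 1) k * poch (-(n : ℂ)) k /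
          (k.factorial * (poch q k * poch w k)) *
          (poch b k * poch c k / (poch (1 + a - b) k * poch (1 + a - c) k)) := by
          simp only [List.map_cons, List.map_nil, List.prod_cons, List.prod_nil, one_pow, mul_one]
          rw [div_mul_div_comm]
          congr 1 <;> ring
      _ = _ := by
          rw [← hext, mul_sum]
          exact sum_congr rfl fun j _ => by ring
  rw [hexp, hypTerm, mul_sum]
  refine sum_congr rfl fun j hj => ?_
  have hjn : j ≤ n := Nat.lt_succ_iff.1 (mem_range.1 hj)
  have hj0 := hvj j hjn
  have hβr : poch (β + 1) j = poch β j * ((q * (1 + a - w) + (n : ℂ) * (a - q) +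
      j * (1 + 2 * q - w + n)) / (q * (1 + a - w) + (n : ℂ) * (a - q))) := by
    apply mul_left_cancel₀ hβ0
    rw [mul_poch_add_one]
    have h2 : β * (1 + 2 * q - w + n) = q * (1 + a - w) + (n : ℂ) * (a - q) := by
      rw [hβ]; exact div_mul_cancel₀ _ hqw
    have h3 : β * ((q * (1 + a - w) + (n : ℂ) * (a - q) + j * (1 + 2 * q - w + n)) /
        (q * (1 + a - w) + (n : ℂ) * (a - q))) = β + j := by
      rw [mul_div_assoc', div_eq_iff hP]
      linear_combination (j : ℂ) * h2
    rw [mul_left_comm, h3]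
  have hβj := poch_ne_zero_of_le hβn hjn
  have hBj := poch_ne_zero_of_le hB hjn
  have hCj := poch_ne_zero_of_le hC hjn
  have hh1j := poch_ne_zero_of_le hh1 hjn
  have hh2j := poch_ne_zero_of_le hh2 hjn
  have hjf : (j.factorial : ℂ) ≠ 0 := by exact_mod_cast j.factorial_ne_zero
  have hda := poch_two_mul a j
  have hdw := poch_two_mul (2 + a - w - n) j
  rw [show 2 + a - w - (n : ℂ) + 1 = 3 + a - w - n by ring] at hdw
  obtain ⟨N, rfl⟩ := Nat.exists_eq_add_of_le hjn
  have hin := sum_range_inner a q w j N hq hq0 hw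
  have hv := poch_mul_poch_neg (w - a - 1) j N
  rw [show -(w - a - 1) = 1 + a - w by ring,
    show 1 - (w - a - 1) - ((j + N : ℕ) : ℂ) = 2 + a - w - ((j + N : ℕ) : ℂ) by ring, hdw] at hv
  rw [mul_div_mul_comm, hαr]
  simp only [List.map_cons, List.map_nil, List.prod_cons, List.prod_nil, one_pow, mul_one]
  rw [hβr]
  apply mul_left_cancel₀ hj0
  rw [mul_left_comm, hin, hda]
  generalize poch (w - a - 1) (j + N) = X at *
  generalize poch (1 + a - w) j = Y at *
  generalize poch ((2 + a - w - ((j + N : ℕ) : ℂ)) / 2) j = H₁ at *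
  generalize poch ((3 + a - w - ((j + N : ℕ) : ℂ)) / 2) j = H₂ at *
  generalize poch (w - a - 1 - j) N = V at *
  generalize poch (-((j + N : ℕ) : ℂ)) j = M at *
  generalize poch w (j + N) = W at *
  generalize poch (1 + a - b) j = B₁ at *
  generalize poch (1 + a - c) j = C₁ at *
  generalize poch (1 + a - b - c) j = D at *
  generalize poch (a / 2) j = A₁ at *
  generalize poch ((a + 1) / 2) j = A₂ at *
  generalize poch β j = b₁ at *
  push_cast at hP ⊢
  have hbr : (q + j) * (w - a - 1 - j + N) - (a + 2 * j) * N =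
      -(q * (1 + a - w) + (j + N) * (a - q) + j * (1 + 2 * q - w + (j + N))) := by ring
  rw [hbr]
  generalize q * (1 + a - w) + (j + N) * (a - q) + j * (1 + 2 * q - w + (j + N)) = Q
  generalize q * (1 + a - w) + ((j : ℂ) + N) * (a - q) = P at hP ⊢
  trans X * Y * (w - a - 1 - j) / W * (P / (q * (1 + a - w))) *
    (A₁ * A₂ * D * b₁ * (Q / P) * M / (j.factorial * B₁ * C₁ * H₁ * H₂ * b₁))
  · rw [hv]
    field_simp
    ring
  · ring
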